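/- arXiv:2310.12095 — 2 statements merged into one kernel-verified Lean document; each statement's English description precedes it below -/
import Mathlib

section
/- Let G : (W,‖·‖_W) → (V,‖·‖_V) be any operator between two normed spaces. Then for all w, w′ ∈ W one has the Taylor–Lagrange type inequality ‖G(w) − G(w′)‖_V ≤ (sup_{0≤t≤1} ‖∂G‖(t w + (1−t) w′)) · ‖w − w′‖_W, where the right-hand side is interpreted as +∞ (and the inequality trivially holds) if the supremum is infinite. -/
open Filter Topology
open scoped ENNReal

/-- The local variation of an operator `G` between normed spaces at a point `w`:
`‖∂G‖(w) := limsup_{h→0, h≠0} ‖G(w+h) − G(w)‖ / ‖h‖`, a value in `[0,+∞]`. -/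
noncomputable def locVar {W V : Type*} [NormedAddCommGroup W] [NormedAddCommGroup V]
    (G : W → V) (w : W) : ℝ≥0∞ :=
  Filter.limsup (fun h : W => ENNReal.ofReal (‖G (w + h) - G w‖ / ‖h‖)) (𝓝[≠] (0 : W))

/-- A bound on the local variation is a local Lipschitz-type estimate at the point. -/
theorem eventually_norm_sub_le_of_locVar_lt {W V : Type*} [NormedAddCommGroup W]
    [NormedAddCommGroup V] {G : W → V} {x : W} {C : ℝ} (h : locVar G x < ENNReal.ofReal C) :
    ∀ᶠ k in 𝓝 (0 : W), ‖G (x + k) - G x‖ ≤ C * ‖k‖ := by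
  have hev := eventually_nhdsWithin_iff.1 (eventually_lt_of_limsup_lt h)
  filter_upwards [hev] with k hk
  by_cases hk0 : k = 0
  · simp [hk0]
  · have hlt := (ENNReal.ofReal_lt_ofReal_iff_of_nonneg (by positivity)).1 (hk hk0)
    exact ((div_lt_iff₀ (norm_pos_iff.2 hk0)).1 hlt).le

/-- Restriction to a line of the estimate given by a bound on the local variation. -/
theorem eventually_norm_sub_le_line {W V : Type*} [NormedAddCommGroup W] [NormedSpace ℝ W]
    [NormedAddCommGroup V] {G : W → V} {p d : W} {t C : ℝ}
    (h : locVar G (p + t • d) < ENNReal.ofReal C) :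
    ∀ᶠ z in 𝓝 t, ‖G (p + z • d) - G (p + t • d)‖ ≤ C * ‖d‖ * |z - t| := by
  have hcont : Tendsto (fun z : ℝ => (z - t) • d) (𝓝 t) (𝓝 0) := by
    have : Continuous fun z : ℝ => (z - t) • d := by fun_prop
    simpa using this.tendsto t
  filter_upwards [hcont.eventually (eventually_norm_sub_le_of_locVar_lt h)] with z hz
  have hadd : p + t • d + (z - t) • d = p + z • d := by module
  rw [hadd, norm_smul, Real.norm_eq_abs] at hz
  linarith

/-- If the local variation is at most `S` along a segment, then the increment over the segment is
at most `S` times its length. -/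
theorem norm_sub_le_of_locVar_le {W V : Type*} [NormedAddCommGroup W] [NormedSpace ℝ W]
    [NormedAddCommGroup V] {G : W → V} {p d : W} (hd : d ≠ 0) {S : ℝ} (hS : 0 ≤ S)
    (h : ∀ t ∈ Set.Icc (0 : ℝ) 1, locVar G (p + t • d) ≤ ENNReal.ofReal S) :
    ‖G (p + d) - G p‖ ≤ S * ‖d‖ := by
  have hd' : 0 < ‖d‖ := norm_pos_iff.2 hd
  have hloc : ∀ C, S < C → ∀ t ∈ Set.Icc (0 : ℝ) 1,
      ∀ᶠ z in 𝓝 t, ‖G (p + z • d) - G (p + t • d)‖ ≤ C * ‖d‖ * |z - t| := fun C hC t ht =>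
    eventually_norm_sub_le_line
      ((h t ht).trans_lt ((ENNReal.ofReal_lt_ofReal_iff_of_nonneg hS).2 hC))
  have hG : ContinuousOn (fun t : ℝ => G (p + t • d)) (Set.Icc 0 1) := fun t ht => by
    refine ContinuousAt.continuousWithinAt (tendsto_iff_norm_sub_tendsto_zero.2 ?_)
    refine squeeze_zero' (.of_forall fun _ => norm_nonneg _)
      (hloc (S + 1) (lt_add_one S) t ht) ?_
    have : Continuous fun z : ℝ => (S + 1) * ‖d‖ * |z - t| := by fun_prop
    simpa using this.tendsto t
  have key := image_le_of_liminf_slope_right_le_deriv_boundary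
    (f := fun t : ℝ => ‖G (p + t • d) - G p‖) (a := 0) (b := 1)
    (B := fun t => S * ‖d‖ * t) (B' := fun _ => S * ‖d‖)
    (hG.sub continuousOn_const).norm (by simp) (by fun_prop)
    (fun x _ => by simpa using ((hasDerivAt_id x).const_mul (S * ‖d‖)).hasDerivWithinAt) ?_
    (Set.right_mem_Icc.2 zero_le_one)
  · simpa using key
  · intro x hx r hr
    obtain ⟨q, hq, hqr⟩ := exists_between hr
    have hev := nhdsWithin_le_nhds (s := Set.Ioi x)
      (hloc (q / ‖d‖) ((lt_div_iff₀ hd').2 hq) x (Set.Ico_subset_Icc_self hx))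
    refine Eventually.frequently ?_
    filter_upwards [hev, self_mem_nhdsWithin] with z hz hxz
    have hpos : 0 < z - x := sub_pos.2 hxz
    rw [div_mul_cancel₀ _ hd'.ne', abs_of_pos hpos] at hz
    have htri := norm_sub_norm_le (G (p + z • d) - G p) (G (p + x • d) - G p)
    rw [sub_sub_sub_cancel_right] at htri
    rw [slope_def_field, div_lt_iff₀ hpos]
    exact (htri.trans hz).trans_lt (mul_lt_mul_of_pos_right hqr hpos)

/-- **Taylor–Lagrange type inequality.** For all `w, w′`,
`‖G(w) − G(w′)‖ ≤ (sup_{0≤t≤1} ‖∂G‖(t w + (1−t) w′)) · ‖w − w′‖`, the inequality being read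
in `[0,+∞]` (it trivially holds if the supremum is infinite). -/
theorem stmt_5 {W V : Type*} [NormedAddCommGroup W] [NormedSpace ℝ W] [NormedAddCommGroup V]
    (G : W → V) (w w' : W) :
    ENNReal.ofReal ‖G w - G w'‖ ≤
      (⨆ t ∈ Set.Icc (0 : ℝ) 1, locVar G (t • w + (1 - t) • w')) *
        ENNReal.ofReal ‖w - w'‖ := by
  by_cases hw : w = w'
  · simp [hw]
  have hd : w - w' ≠ 0 := sub_ne_zero.2 hw
  set S := ⨆ t ∈ Set.Icc (0 : ℝ) 1, locVar G (t • w + (1 - t) • w') with hS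
  by_cases htop : S = ⊤
  · rw [htop, ENNReal.top_mul (by simpa using hd)]
    exact le_top
  rw [← ENNReal.ofReal_toReal htop, ← ENNReal.ofReal_mul ENNReal.toReal_nonneg]
  have hbound := norm_sub_le_of_locVar_le (G := G) (p := w') hd
    (S := S.toReal) ENNReal.toReal_nonneg fun t ht => by
      rw [ENNReal.ofReal_toReal htop,
        show w' + t • (w - w') = t • w + (1 - t) • w' by module, hS]
      exact le_iSup₂ (f := fun t (_ : t ∈ Set.Icc (0 : ℝ) 1) =>
        locVar G (t • w + (1 - t) • w')) t ht
  rw [add_sub_cancel] at hbound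
  exact ENNReal.ofReal_le_ofReal hbound
end

section
/- Let Ω ⊂ ℝ^d be compact, let Cov : Ω×Ω → ℝ be Lipschitz continuous with Lipschitz constant L > 0, and set M := max_{x∈Ω} Cov(x,x). Suppose λ₁ ≥ λ₂ ≥ … ≥ 0 is a summable sequence and φ_i : Ω → ℝ are functions such that Cov(x,y) = Σ_{i=1}^∞ λ_i φ_i(x) φ_i(y) for all x, y ∈ Ω (the series converging absolutely pointwise). Then for all 1 ≤ p ≤ q ≤ +∞ and all x, x′, y, y′ ∈ Ω, the truncated kernels Cov_{p,q}(x,y) := Σ_{i=p}^{q} λ_i φ_i(x) φ_i(y) satisfy |Cov_{p,q}(x,y) − Cov_{p,q}(x′,y′)| ≤ √(2LM|x−x′|) + √(2LM|y−y′|); in particular all the truncated kernels are 1/2-Hölder continuous with a common Hölder constant √(2LM) (in each variable). -/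
open scoped ENNReal

/-- Weighted Cauchy–Schwarz inequality for finite sums, with bounds on the two factors. -/
theorem abs_sum_weight_mul_le_sqrt {ι : Type*} (S : Finset ι) (w f g : ι → ℝ)
    (hw : ∀ i, 0 ≤ w i) {A B : ℝ} (hA : ∑ i ∈ S, w i * f i * f i ≤ A)
    (hB : ∑ i ∈ S, w i * g i * g i ≤ B) :
    |∑ i ∈ S, w i * f i * g i| ≤ Real.sqrt (A * B) := by
  apply Real.abs_le_sqrt
  have h := Finset.sum_mul_sq_le_sq_mul_sq S (fun i => Real.sqrt (w i) * f i)
    (fun i => Real.sqrt (w i) * g i)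
  have e : ∀ u v : ℝ, ∀ i, Real.sqrt (w i) * u * (Real.sqrt (w i) * v) = w i * u * v := by
    intro u v i
    rw [mul_mul_mul_comm, Real.mul_self_sqrt (hw i), mul_assoc]
  simp only [sq (Real.sqrt _ * _), e] at h
  have nonneg : ∀ u : ι → ℝ, 0 ≤ ∑ i ∈ S, w i * u i * u i := fun u =>
    Finset.sum_nonneg fun i _ => by
      rw [mul_assoc]
      exact mul_nonneg (hw i) (mul_self_nonneg _)
  exact h.trans (mul_le_mul hA hB (nonneg g) ((nonneg f).trans hA))

/-- Let `Ω ⊂ ℝ^d` be compact, `Cov : Ω×Ω → ℝ` Lipschitz with constant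
`L > 0`, and `M := sup_{x∈Ω} Cov(x,x)`. Suppose `λ₁ ≥ λ₂ ≥ … ≥ 0` is summable and the
`φ_i` satisfy `Cov(x,y) = Σ λ_i φ_i(x)φ_i(y)` for all `x,y ∈ Ω`, the series converging
absolutely pointwise. Then for every index window `p ≤ q` (finite, or the infinite tail
`q = ∞`) and all `x, x′, y, y′ ∈ Ω` the truncated kernels
`Cov_{p,q}(x,y) := Σ_{i=p}^{q} λ_i φ_i(x)φ_i(y)` satisfy
`|Cov_{p,q}(x,y) − Cov_{p,q}(x′,y′)| ≤ √(2LM|x−x′|) + √(2LM|y−y′|)`;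
in particular they are `1/2`-Hölder with the common constant `√(2LM)`. -/
theorem stmt_9 (d : ℕ) (Ωs : Set (EuclideanSpace ℝ (Fin d))) (hΩ : IsCompact Ωs)
    (Cov : EuclideanSpace ℝ (Fin d) → EuclideanSpace ℝ (Fin d) → ℝ)
    (L : ℝ) (hL : 0 < L)
    (hLip : ∀ x ∈ Ωs, ∀ y ∈ Ωs, ∀ x' ∈ Ωs, ∀ y' ∈ Ωs,
      |Cov x y - Cov x' y'| ≤
        L * dist ((x, y) : EuclideanSpace ℝ (Fin d) × EuclideanSpace ℝ (Fin d)) (x', y'))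
    (lam : ℕ → ℝ) (hmono : Antitone lam) (hnn : ∀ i, 0 ≤ lam i) (hsum : Summable lam)
    (φ : ℕ → EuclideanSpace ℝ (Fin d) → ℝ)
    (habs : ∀ x ∈ Ωs, ∀ y ∈ Ωs, Summable fun i => |lam i * φ i x * φ i y|)
    (hMercer : ∀ x ∈ Ωs, ∀ y ∈ Ωs, ∑' i, lam i * φ i x * φ i y = Cov x y) :
    ∀ x ∈ Ωs, ∀ y ∈ Ωs, ∀ x' ∈ Ωs, ∀ y' ∈ Ωs,
      (∀ p q : ℕ, p ≤ q →
        |(∑ i ∈ Finset.Icc p q, lam i * φ i x * φ i y) -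
            ∑ i ∈ Finset.Icc p q, lam i * φ i x' * φ i y'| ≤
          Real.sqrt (2 * L * sSup ((fun z => Cov z z) '' Ωs) * dist x x') +
            Real.sqrt (2 * L * sSup ((fun z => Cov z z) '' Ωs) * dist y y')) ∧
      (∀ p : ℕ,
        |(∑' i, if p ≤ i then lam i * φ i x * φ i y else 0) -
            ∑' i, if p ≤ i then lam i * φ i x' * φ i y' else 0| ≤
          Real.sqrt (2 * L * sSup ((fun z => Cov z z) '' Ωs) * dist x x') +
            Real.sqrt (2 * L * sSup ((fun z => Cov z z) '' Ωs) * dist y y')) := by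
  have sm : ∀ x ∈ Ωs, ∀ y ∈ Ωs, Summable fun i => lam i * φ i x * φ i y :=
    fun x hx y hy => (habs x hx y hy).of_abs
  have hs : ∀ x ∈ Ωs, ∀ y ∈ Ωs, HasSum (fun i => lam i * φ i x * φ i y) (Cov x y) :=
    fun x hx y hy => hMercer x hx y hy ▸ (sm x hx y hy).hasSum
  have diag : ∀ S : Finset ℕ, ∀ y ∈ Ωs,
      ∑ i ∈ S, lam i * φ i y * φ i y ≤ sSup ((fun z => Cov z z) '' Ωs) := by
    intro S y hy
    have bdd : BddAbove ((fun z => Cov z z) '' Ωs) := by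
      refine ⟨Cov y y + L * Metric.diam Ωs, ?_⟩
      rintro _ ⟨z, hz, rfl⟩
      have h1 := (abs_le.1 (hLip z hz z hz y hy y hy)).2
      have h2 := mul_le_mul_of_nonneg_left (Metric.dist_le_diam_of_mem hΩ.isBounded hz hy) hL.le
      simp only [Prod.dist_eq, max_self] at h1
      change Cov z z ≤ _
      linarith
    refine (sum_le_hasSum S (fun i _ => ?_) (hs y hy y hy)).trans
      (le_csSup bdd ⟨y, hy, rfl⟩)
    rw [mul_assoc]
    exact mul_nonneg (hnn i) (mul_self_nonneg _)
  have incr : ∀ S : Finset ℕ, ∀ x ∈ Ωs, ∀ x' ∈ Ωs,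
      ∑ i ∈ S, lam i * (φ i x - φ i x') * (φ i x - φ i x') ≤ 2 * L * dist x x' := by
    intro S x hx x' hx'
    have h := ((hs x hx x hx).sub (hs x hx x' hx')).add
      ((hs x' hx' x' hx').sub (hs x' hx' x hx))
    have h' : HasSum (fun i => lam i * (φ i x - φ i x') * (φ i x - φ i x'))
        (Cov x x - Cov x x' + (Cov x' x' - Cov x' x)) := by
      refine (congrArg (HasSum · _) (funext fun i => ?_)).mpr h
      ring
    have h1 := (abs_le.1 (hLip x hx x hx x hx x' hx')).2
    have h2 := (abs_le.1 (hLip x' hx' x' hx' x' hx' x hx)).2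
    simp only [Prod.dist_eq, dist_self, dist_nonneg, max_eq_right, dist_comm x' x] at h1 h2
    refine (sum_le_hasSum S (fun i _ => ?_) h').trans (by linarith)
    rw [mul_assoc]
    exact mul_nonneg (hnn i) (mul_self_nonneg _)
  intro x hx y hy x' hx' y' hy'
  have fin : ∀ S : Finset ℕ,
      |(∑ i ∈ S, lam i * φ i x * φ i y) - ∑ i ∈ S, lam i * φ i x' * φ i y'| ≤
        Real.sqrt (2 * L * sSup ((fun z => Cov z z) '' Ωs) * dist x x') +
          Real.sqrt (2 * L * sSup ((fun z => Cov z z) '' Ωs) * dist y y') := by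
    intro S
    have hX := abs_sum_weight_mul_le_sqrt S lam (fun i => φ i x - φ i x') (fun i => φ i y) hnn
      (incr S x hx x' hx') (diag S y hy)
    have hY := abs_sum_weight_mul_le_sqrt S lam (fun i => φ i y - φ i y') (fun i => φ i x') hnn
      (incr S y hy y' hy') (diag S x' hx')
    rw [mul_right_comm] at hX hY
    have e : (∑ i ∈ S, lam i * φ i x * φ i y) - ∑ i ∈ S, lam i * φ i x' * φ i y' =
        (∑ i ∈ S, lam i * (φ i x - φ i x') * φ i y) +
          ∑ i ∈ S, lam i * (φ i y - φ i y') * φ i x' := by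
      rw [← Finset.sum_sub_distrib, ← Finset.sum_add_distrib]
      exact Finset.sum_congr rfl fun i _ => by ring
    rw [e]
    exact (abs_add_le _ _).trans (add_le_add hX hY)
  refine ⟨fun p q _ => fin _, fun p => ?_⟩
  have tail : ∀ x ∈ Ωs, ∀ y ∈ Ωs,
      Summable fun i => if p ≤ i then lam i * φ i x * φ i y else 0 :=
    fun x hx y hy => ((sm x hx y hy).indicator {i | p ≤ i}).congr fun i => by
      simp [Set.indicator_apply]
  refine le_of_tendsto
    (Filter.Tendsto.abs (Filter.Tendsto.sub (tail x hx y hy).hasSum (tail x' hx' y' hy').hasSum))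
    (Filter.Eventually.of_forall fun S => ?_)
  simp only [← Finset.sum_filter]
  exact fin _
end
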